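/- Let F be a field, h ∈ Sp_4(F), and v(x,y,z) ∈ N_{2,8}(F). Let (x̃ | ỹ) ∈ Mat_{2×4}(F) be the product of the 2×4 matrix (x | y) with h, where x̃, ỹ are its left and right 2×2 halves. Then v(x̃,ỹ,z) ∈ N_{2,8}(F) and v(x,y,z) · diag(I_2, h, I_2) = diag(I_2, h, I_2) · v(x̃,ỹ,z). -/

import Mathlib

open Matrix

namespace GS

noncomputable section

/-- `Jmat F n` : the `n × n` matrix over `F` with ones on the antidiagonal, zeros elsewhere. -/
def Jmat (F : Type*) [Field F] (n : ℕ) : Matrix (Fin n) (Fin n) F :=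
  Matrix.of fun i j => if (i : ℕ) + (j : ℕ) = n - 1 then (1 : F) else 0

/-- The symplectic form matrix `((0, J_n), (-J_n, 0))` in `n × n` block form. -/
def OmegaMat (F : Type*) [Field F] (n : ℕ) : Matrix (Fin (n + n)) (Fin (n + n)) F :=
  Matrix.reindex finSumFinEquiv finSumFinEquiv
    (Matrix.fromBlocks 0 (Jmat F n) (-(Jmat F n)) 0)

/-- `Sp_{2n}(F) = { g : ᵗg Ω g = Ω }`. -/
def SpSet (F : Type*) [Field F] (n : ℕ) : Set (Matrix (Fin (n + n)) (Fin (n + n)) F) :=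
  {g | gᵀ * OmegaMat F n * g = OmegaMat F n}

/-- `Sp_4(F)`. -/
def Sp4 (F : Type*) [Field F] : Set (Matrix (Fin 4) (Fin 4) F) := SpSet F 2

/-- `Sp_8(F)`. -/
def Sp8 (F : Type*) [Field F] : Set (Matrix (Fin 8) (Fin 8) F) := SpSet F 4

/-- `Sp_16(F)`. -/
def Sp16 (F : Type*) [Field F] : Set (Matrix (Fin 16) (Fin 16) F) := SpSet F 8

/-- `Mat_2^0(F) = { A : ᵗA J₂ = J₂ A }`. -/
def Mat20 (F : Type*) [Field F] : Set (Matrix (Fin 2) (Fin 2) F) :=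
  {A | Aᵀ * Jmat F 2 = Jmat F 2 * A}

/-- `y* = J₂ ᵗy J₂`. -/
def starJ (F : Type*) [Field F] (y : Matrix (Fin 2) (Fin 2) F) : Matrix (Fin 2) (Fin 2) F :=
  Jmat F 2 * yᵀ * Jmat F 2

/-- Assemble an `8 × 8` matrix from sixteen `2 × 2` blocks. -/
def blk8 (F : Type*) [Field F] (B : Fin 4 → Fin 4 → Matrix (Fin 2) (Fin 2) F) :
    Matrix (Fin 8) (Fin 8) F :=
  Matrix.of fun i j =>
    B ⟨(i : ℕ) / 2, by have := i.isLt; omega⟩ ⟨(j : ℕ) / 2, by have := j.isLt; omega⟩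
      ⟨(i : ℕ) % 2, by omega⟩ ⟨(j : ℕ) % 2, by omega⟩

/-- The matrix `v(x, y, z)`: identity except block `(1,2) = x`, `(1,3) = y`,
`(1,4) = z`, `(2,4) = y* = J₂ ᵗy J₂`, `(3,4) = x* = -J₂ ᵗx J₂`. -/
def vMat (F : Type*) [Field F] (x y z : Matrix (Fin 2) (Fin 2) F) :
    Matrix (Fin 8) (Fin 8) F :=
  blk8 F fun bi bj =>
    if bi = bj then (1 : Matrix (Fin 2) (Fin 2) F)
    else if bi = 0 ∧ bj = 1 then x
    else if bi = 0 ∧ bj = 2 then y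
    else if bi = 0 ∧ bj = 3 then z
    else if bi = 1 ∧ bj = 3 then starJ F y
    else if bi = 2 ∧ bj = 3 then -(starJ F x)
    else 0

/-- `N_{2,8}(F)`. -/
def N28 (F : Type*) [Field F] : Set (Matrix (Fin 8) (Fin 8) F) :=
  {M | ∃ x y z : Matrix (Fin 2) (Fin 2) F,
    z - x * starJ F y ∈ Mat20 F ∧ M = vMat F x y z}

/-- The center subgroup `N_{2,8}^c(F) = { v(0,0,z) : z ∈ Mat_2^0(F) }`. -/
def N28c (F : Type*) [Field F] : Set (Matrix (Fin 8) (Fin 8) F) :=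
  {M | ∃ z ∈ Mat20 F, M = vMat F 0 0 z}

/-- The underlying set of the Heisenberg group `H_9(F)`. -/
abbrev H9 (F : Type*) [Field F] :=
  Matrix (Fin 2) (Fin 2) F × Matrix (Fin 2) (Fin 2) F × F

/-- The Heisenberg multiplication on `H_9(F)` attached to `T`. -/
def H9mul (F : Type*) [Field F] (T : Matrix (Fin 2) (Fin 2) F) (a b : H9 F) : H9 F :=
  (a.1 + b.1, a.2.1 + b.2.1,
    a.2.2 + b.2.2 +
      (T * (a.1 * (Jmat F 2 * b.2.1ᵀ * Jmat F 2) -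
            a.2.1 * (Jmat F 2 * b.1ᵀ * Jmat F 2))).trace)

/-- The `8 × 8` block diagonal matrix `diag(m, h, m')` with blocks of sizes `2, 4, 2`. -/
def diag242 (F : Type*) [Field F] (m : Matrix (Fin 2) (Fin 2) F)
    (h : Matrix (Fin 4) (Fin 4) F) (m' : Matrix (Fin 2) (Fin 2) F) :
    Matrix (Fin 8) (Fin 8) F :=
  Matrix.of fun i j =>
    if hi : (i : ℕ) < 2 then
      if hj : (j : ℕ) < 2 then m ⟨(i : ℕ), hi⟩ ⟨(j : ℕ), hj⟩ else 0
    else if hi2 : (i : ℕ) < 6 then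
      if hj2 : 2 ≤ (j : ℕ) ∧ (j : ℕ) < 6 then
        h ⟨(i : ℕ) - 2, by omega⟩ ⟨(j : ℕ) - 2, by omega⟩
      else 0
    else
      if hj3 : 6 ≤ (j : ℕ) then
        m' ⟨(i : ℕ) - 6, by have := i.isLt; omega⟩ ⟨(j : ℕ) - 6, by have := j.isLt; omega⟩
      else 0

/-- The segment (`{1,2}`, `{3,4,5,6}` or `{7,8}`) of an index in `Fin 8`. -/
def seg8 (i : Fin 8) : ℕ := if (i : ℕ) < 2 then 0 else if (i : ℕ) < 6 then 1 else 2

/-- `w = ((0, I₂), (I₂, 0))`. -/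
def wMat (F : Type*) [Field F] : Matrix (Fin 4) (Fin 4) F :=
  Matrix.reindex finSumFinEquiv finSumFinEquiv
    (Matrix.fromBlocks (0 : Matrix (Fin 2) (Fin 2) F) (1 : Matrix (Fin 2) (Fin 2) F)
      (1 : Matrix (Fin 2) (Fin 2) F) (0 : Matrix (Fin 2) (Fin 2) F))

/-- The embedding `t : Sp₄ × Sp₄ → Mat₁₆`, with respect to the partition of `{1,…,16}`
into `I₁ = {1,…,4}`, `I₂ = {5,6}`, `I₃ = {7,…,10}`, `I₄ = {11,12}`, `I₅ = {13,…,16}`: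
block `(I₁,I₁) = g₁`, `(I₃,I₃) = g₂`, `(I₅,I₅) = J₄ ᵗg₁⁻¹ J₄`, `(I₂,I₂) = g_{1,1}`,
`(I₂,I₄) = g_{1,2}`, `(I₄,I₂) = g_{1,3}`, `(I₄,I₄) = g_{1,4}`, all other blocks zero. -/
def tEmb (F : Type*) [Field F] (g₁ g₂ : Matrix (Fin 4) (Fin 4) F) :
    Matrix (Fin 16) (Fin 16) F :=
  Matrix.of fun i j =>
    if hi1 : (i : ℕ) < 4 then
      if hj1 : (j : ℕ) < 4 then g₁ ⟨(i : ℕ), hi1⟩ ⟨(j : ℕ), hj1⟩ else 0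
    else if hi2 : (i : ℕ) < 6 then
      if hj2 : 4 ≤ (j : ℕ) ∧ (j : ℕ) < 6 then
        g₁ ⟨(i : ℕ) - 4, by omega⟩ ⟨(j : ℕ) - 4, by omega⟩
      else if hj4 : 10 ≤ (j : ℕ) ∧ (j : ℕ) < 12 then
        g₁ ⟨(i : ℕ) - 4, by omega⟩ ⟨(j : ℕ) - 10 + 2, by omega⟩
      else 0
    else if hi3 : (i : ℕ) < 10 then
      if hj3 : 6 ≤ (j : ℕ) ∧ (j : ℕ) < 10 then
        g₂ ⟨(i : ℕ) - 6, by omega⟩ ⟨(j : ℕ) - 6, by omega⟩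
      else 0
    else if hi4 : (i : ℕ) < 12 then
      if hj2 : 4 ≤ (j : ℕ) ∧ (j : ℕ) < 6 then
        g₁ ⟨(i : ℕ) - 10 + 2, by omega⟩ ⟨(j : ℕ) - 4, by omega⟩
      else if hj4 : 10 ≤ (j : ℕ) ∧ (j : ℕ) < 12 then
        g₁ ⟨(i : ℕ) - 10 + 2, by omega⟩ ⟨(j : ℕ) - 10 + 2, by omega⟩
      else 0
    else
      if hj5 : 12 ≤ (j : ℕ) then
        (Jmat F 4 * (g₁⁻¹)ᵀ * Jmat F 4) ⟨(i : ℕ) - 12, by have := i.isLt; omega⟩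
          ⟨(j : ℕ) - 12, by have := j.isLt; omega⟩
      else 0

/-- `γ₁`: entry `(1,8) = -1`, entries `(k,k) = 1` for `2 ≤ k ≤ 7`, entry `(8,1) = 1`
(1-indexed), all other entries `0`. -/
def gamma1 (F : Type*) [Field F] : Matrix (Fin 8) (Fin 8) F :=
  Matrix.of fun i j =>
    if (i : ℕ) = 0 ∧ (j : ℕ) = 7 then -1
    else if (i : ℕ) = 7 ∧ (j : ℕ) = 0 then 1
    else if i = j ∧ 1 ≤ (i : ℕ) ∧ (i : ℕ) ≤ 6 then 1
    else 0

/-- `γ₂`: block (rows 1–2, columns 7–8) `= -I₂`, block (rows 3–6, columns 3–6) `= I₄`,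
block (rows 7–8, columns 1–2) `= I₂` (1-indexed), all other entries `0`. -/
def gamma2 (F : Type*) [Field F] : Matrix (Fin 8) (Fin 8) F :=
  Matrix.of fun i j =>
    if (i : ℕ) < 2 ∧ (j : ℕ) = (i : ℕ) + 6 then -1
    else if 2 ≤ (i : ℕ) ∧ (i : ℕ) < 6 ∧ i = j then 1
    else if 6 ≤ (i : ℕ) ∧ (j : ℕ) + 6 = (i : ℕ) then 1
    else 0

/-- The Siegel parabolic `P_8(F)` of `Sp_8(F)`: lower-left `4 × 4` block zero. -/
def P8 (F : Type*) [Field F] : Set (Matrix (Fin 8) (Fin 8) F) :=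
  {g | g ∈ Sp8 F ∧ ∀ i j : Fin 8, 4 ≤ (i : ℕ) → (j : ℕ) < 4 → g i j = 0}

/-- The Siegel parabolic `P_4(F)` of `Sp_4(F)`: lower-left `2 × 2` block zero. -/
def P4 (F : Type*) [Field F] : Set (Matrix (Fin 4) (Fin 4) F) :=
  {h | h ∈ Sp4 F ∧ ∀ i j : Fin 4, 2 ≤ (i : ℕ) → (j : ℕ) < 2 → h i j = 0}

/-- The span of the first two standard basis vectors `e₁, e₂` of `F^8`. -/
def E2 (F : Type*) [Field F] : Submodule F (Fin 8 → F) :=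
  Submodule.span F {Pi.single (0 : Fin 8) (1 : F), Pi.single (1 : Fin 8) (1 : F)}

/-- `P_{2,8}(F)`: elements of `Sp_8(F)` mapping the span of `e₁, e₂` onto itself. -/
def P28 (F : Type*) [Field F] : Set (Matrix (Fin 8) (Fin 8) F) :=
  {g | g ∈ Sp8 F ∧ Submodule.map g.mulVecLin (E2 F) = E2 F}

/-- The double coset `P_8(F) · γ · P_{2,8}(F)`. -/
def dcoset (F : Type*) [Field F] (γ : Matrix (Fin 8) (Fin 8) F) :
    Set (Matrix (Fin 8) (Fin 8) F) :=
  {g | ∃ p ∈ P8 F, ∃ q ∈ P28 F, g = p * γ * q}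

/-- The orbit of `ξ` under the right multiplication action of `GL₂(F)` on `Mat₂(F)`. -/
def rOrbit (F : Type*) [Field F] (ξ : Matrix (Fin 2) (Fin 2) F) :
    Set (Matrix (Fin 2) (Fin 2) F) :=
  {A | ∃ g, IsUnit g ∧ A = ξ * g}


/-- The `2 × 4` matrix `(x | y)`. -/
def hcat (F : Type*) [Field F] (x y : Matrix (Fin 2) (Fin 2) F) : Matrix (Fin 2) (Fin 4) F :=
  (fromCols x y).submatrix id (finSumFinEquiv (m := 2) (n := 2)).symm

/-- The splitting of the index set of `8 × 8` matrices into segments of sizes `2, 4, 2`. -/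
def segEquiv : Fin 2 ⊕ (Fin 4 ⊕ Fin 2) ≃ Fin 8 :=
  ((Equiv.refl _).sumCongr (finSumFinEquiv (m := 4) (n := 2))).trans
    (finSumFinEquiv (m := 2) (n := 6))

theorem Jmat_two_mul_self (F : Type*) [Field F] : Jmat F 2 * Jmat F 2 = 1 := by
  ext i j
  fin_cases i <;> fin_cases j <;> simp [Jmat, Matrix.mul_apply, Fin.sum_univ_two]

theorem Jmat_two_transpose (F : Type*) [Field F] : (Jmat F 2)ᵀ = Jmat F 2 := by
  ext i j
  simp [Jmat, add_comm]

theorem OmegaMat_two_mul_self (F : Type*) [Field F] : OmegaMat F 2 * OmegaMat F 2 = -1 := by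
  simp only [OmegaMat, reindex_apply, submatrix_mul_equiv, fromBlocks_multiply]
  have hneg : (fromBlocks (-1) 0 0 (-1) : Matrix (Fin 2 ⊕ Fin 2) (Fin 2 ⊕ Fin 2) F) = -1 := by
    rw [← fromBlocks_one, fromBlocks_neg, neg_zero]
  simp [Jmat_two_mul_self, hneg, submatrix_neg]

theorem Sp4_mul_OmegaMat_mul_transpose {F : Type*} [Field F] {h : Matrix (Fin 4) (Fin 4) F}
    (hh : h ∈ Sp4 F) : h * OmegaMat F 2 * hᵀ = OmegaMat F 2 := by
  have hh : hᵀ * OmegaMat F 2 * h = OmegaMat F 2 := hh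
  have hΩ := OmegaMat_two_mul_self F
  have hl : (-(OmegaMat F 2 * hᵀ * OmegaMat F 2)) * h = 1 := by
    rw [neg_mul, Matrix.mul_assoc, Matrix.mul_assoc, ← Matrix.mul_assoc hᵀ, hh, hΩ, neg_neg]
  have hr := mul_eq_one_comm.mp hl
  calc h * OmegaMat F 2 * hᵀ
      = -(h * OmegaMat F 2 * hᵀ * (OmegaMat F 2 * OmegaMat F 2)) := by rw [hΩ]; simp
    _ = (h * -(OmegaMat F 2 * hᵀ * OmegaMat F 2)) * OmegaMat F 2 := by
      simp only [Matrix.mul_assoc, Matrix.mul_neg, Matrix.neg_mul]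
    _ = OmegaMat F 2 := by rw [hr, Matrix.one_mul]

theorem hcat_mul_OmegaMat_mul_transpose {F : Type*} [Field F] (x y : Matrix (Fin 2) (Fin 2) F) :
    hcat F x y * OmegaMat F 2 * (hcat F x y)ᵀ = x * Jmat F 2 * yᵀ - y * Jmat F 2 * xᵀ := by
  simp only [hcat, OmegaMat, reindex_apply]
  rw [submatrix_mul_equiv, transpose_submatrix, submatrix_mul_equiv, transpose_fromCols,
    fromCols_mul_fromBlocks, fromCols_mul_fromRows, submatrix_id_id]
  simp [sub_eq_add_neg, add_comm]

theorem sub_mul_starJ_mem_Mat20_iff {F : Type*} [Field F] (x y z : Matrix (Fin 2) (Fin 2) F) :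
    z - x * starJ F y ∈ Mat20 F ↔
      hcat F x y * OmegaMat F 2 * (hcat F x y)ᵀ = z * Jmat F 2 - Jmat F 2 * zᵀ := by
  rw [hcat_mul_OmegaMat_mul_transpose]
  have hJ := Jmat_two_mul_self F
  have hA : (z - x * starJ F y) * Jmat F 2 = z * Jmat F 2 - x * Jmat F 2 * yᵀ := by
    simp [starJ, Matrix.sub_mul, Matrix.mul_assoc, hJ]
  have hB : Jmat F 2 * (z - x * starJ F y)ᵀ = Jmat F 2 * zᵀ - y * Jmat F 2 * xᵀ := by
    rw [← Jmat_two_transpose, ← transpose_mul, hA]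
    simp [Jmat_two_transpose, Matrix.mul_assoc]
  have key : z - x * starJ F y ∈ Mat20 F ↔
      Jmat F 2 * (z - x * starJ F y)ᵀ = (z - x * starJ F y) * Jmat F 2 := by
    generalize z - x * starJ F y = A
    constructor
    · intro (hA : Aᵀ * Jmat F 2 = Jmat F 2 * A)
      calc Jmat F 2 * Aᵀ = Jmat F 2 * (Aᵀ * Jmat F 2) * Jmat F 2 := by
            simp [Matrix.mul_assoc, hJ]
        _ = A * Jmat F 2 := by rw [hA, ← Matrix.mul_assoc, hJ, Matrix.one_mul]
    · intro hA
      change Aᵀ * Jmat F 2 = Jmat F 2 * A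
      calc Aᵀ * Jmat F 2 = Jmat F 2 * (Jmat F 2 * Aᵀ) * Jmat F 2 := by
            simp [← Matrix.mul_assoc, hJ]
        _ = Jmat F 2 * A := by rw [hA, Matrix.mul_assoc, Matrix.mul_assoc, hJ, Matrix.mul_one]
  rw [key, hA, hB, sub_eq_sub_iff_add_eq_add, sub_eq_sub_iff_add_eq_add]
  constructor <;> intro e <;> rw [add_comm, e, add_comm]

theorem OmegaMat_mul_hcat_transpose_mul {F : Type*} [Field F] (x y : Matrix (Fin 2) (Fin 2) F) :
    OmegaMat F 2 * (hcat F x y)ᵀ * Jmat F 2 =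
      (fromRows (starJ F y) (-(starJ F x))).submatrix (finSumFinEquiv (m := 2) (n := 2)).symm
        id := by
  simp only [hcat, OmegaMat, reindex_apply]
  rw [transpose_submatrix, submatrix_mul_equiv, transpose_fromCols, fromBlocks_mul_fromRows]
  conv_lhs => rw [← submatrix_id_id (Jmat F 2)]
  rw [← submatrix_mul _ _ _ _ _ Function.bijective_id, fromRows_mul]
  simp [starJ]

theorem vMat_submatrix_segEquiv {F : Type*} [Field F] (x y z : Matrix (Fin 2) (Fin 2) F) :
    (vMat F x y z).submatrix segEquiv segEquiv =
      fromBlocks 1 (fromCols (hcat F x y) z) 0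
        (fromBlocks 1 (OmegaMat F 2 * (hcat F x y)ᵀ * Jmat F 2) 0 1) := by
  rw [OmegaMat_mul_hcat_transpose_mul]
  ext (i | i | i) (j | j | j) <;> fin_cases i <;> fin_cases j <;> rfl

theorem diag242_submatrix_segEquiv {F : Type*} [Field F] (m : Matrix (Fin 2) (Fin 2) F)
    (h : Matrix (Fin 4) (Fin 4) F) (m' : Matrix (Fin 2) (Fin 2) F) :
    (diag242 F m h m').submatrix segEquiv segEquiv =
      fromBlocks m 0 0 (fromBlocks h 0 0 m') := by
  ext (i | i | i) (j | j | j) <;> fin_cases i <;> fin_cases j <;> rfl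

/-- for `h ∈ Sp_4(F)` and `v(x,y,z) ∈ N_{2,8}(F)`, writing
`(x̃ | ỹ) = (x | y) · h`, one has `v(x̃,ỹ,z) ∈ N_{2,8}(F)` and
`v(x,y,z) · diag(I₂, h, I₂) = diag(I₂, h, I₂) · v(x̃,ỹ,z)`. -/
theorem statement18 (F : Type*) [Field F] (h : Matrix (Fin 4) (Fin 4) F)
    (hh : h ∈ Sp4 F) (x y z : Matrix (Fin 2) (Fin 2) F)
    (hadm : z - x * starJ F y ∈ Mat20 F)
    (xy : Matrix (Fin 2) (Fin 4) F)
    (hxy : ∀ (i : Fin 2) (j : Fin 4), xy i j =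
      if hj : (j : ℕ) < 2 then x i ⟨(j : ℕ), hj⟩
      else y i ⟨(j : ℕ) - 2, by have := j.isLt; omega⟩)
    (xt yt : Matrix (Fin 2) (Fin 2) F)
    (hxt : ∀ i j : Fin 2, xt i j = (xy * h) i ⟨(j : ℕ), by have := j.isLt; omega⟩)
    (hyt : ∀ i j : Fin 2, yt i j = (xy * h) i ⟨(j : ℕ) + 2, by have := j.isLt; omega⟩) :
    vMat F xt yt z ∈ N28 F ∧
    vMat F x y z * diag242 F 1 h 1 = diag242 F 1 h 1 * vMat F xt yt z := by
  have hxy' : xy = hcat F x y := by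
    ext i j
    rw [hxy]
    fin_cases j <;> rfl
  have hxyt : xy * h = hcat F xt yt := by
    ext i j
    fin_cases j
    · exact (hxt i 0).symm
    · exact (hxt i 1).symm
    · exact (hyt i 0).symm
    · exact (hyt i 1).symm
  rw [hxy'] at hxyt
  have hΩ := Sp4_mul_OmegaMat_mul_transpose hh
  refine ⟨⟨xt, yt, z, ?_, rfl⟩, ?_⟩
  · rw [sub_mul_starJ_mem_Mat20_iff] at hadm ⊢
    rw [← hadm, ← hxyt, transpose_mul]
    conv_rhs => rw [← hΩ]
    simp only [Matrix.mul_assoc]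
  · have hcol : h * (OmegaMat F 2 * (hcat F xt yt)ᵀ * Jmat F 2) =
        OmegaMat F 2 * (hcat F x y)ᵀ * Jmat F 2 := by
      conv_rhs => rw [← hΩ]
      simp only [← hxyt, transpose_mul, Matrix.mul_assoc]
    refine (reindex segEquiv.symm segEquiv.symm).injective ?_
    simp only [reindex_apply, Equiv.symm_symm]
    rw [← submatrix_mul_equiv _ _ _ segEquiv, ← submatrix_mul_equiv _ _ _ segEquiv,
      vMat_submatrix_segEquiv, vMat_submatrix_segEquiv, diag242_submatrix_segEquiv]
    simp only [fromBlocks_multiply, fromCols_mul_fromBlocks, hcol, hxyt]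
    simp

end

end GS
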